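/- Let G be a group, (X,π) a separable reflexive isometric Banach G-module, and F ≤ G a subgroup with X^{FC_G(F)} = {0}. Then for every n ≥ 0 the restriction map on reduced cohomology H̄^n(G,X) → H̄^n(F,X) is zero; equivalently, for every φ ∈ Z^n(G,X), the restriction φ|_{Fⁿ} lies in the closure of B^n(F,X) in C^n(F,X). -/

import Mathlib

noncomputable section

open scoped BigOperators

variable {G : Type*} [Group G] {X : Type*} [NormedAddCommGroup X] [NormedSpace ℝ X]

/-- `FC_G(F)`: the set of elements of `G` with finite `F`-conjugacy class. -/
def FCset (F : Subgroup G) : Set G :=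
  {g | Set.Finite {x | ∃ f ∈ F, x = f * g * f⁻¹}}

/-- The coboundary operator `∂^{n+1} : Cⁿ(G,X) → C^{n+1}(G,X)` of the standard
inhomogeneous cochain complex (with the sign conventions of the paper). -/
def cochainD (π : G →* (X →L[ℝ] X)) (n : ℕ) (φ : (Fin n → G) → X) :
    (Fin (n + 1) → G) → X :=
  fun g =>
    -(π (g 0) (φ fun i => g i.succ)) + ((-1 : ℝ) ^ n) • φ (fun i => g i.castSucc)
      - ∑ k : Fin n, ((-1 : ℝ) ^ ((k : ℕ) + 1)) •
          φ (fun j => if (j : ℕ) < (k : ℕ) then g j.castSucc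
            else if (j : ℕ) = (k : ℕ) then g k.castSucc * g k.succ
            else g j.succ)

/-- The space `Zⁿ(G,X) = ker ∂^{n+1}` of `n`-cocycles. -/
def Zset (π : G →* (X →L[ℝ] X)) (n : ℕ) : Set ((Fin n → G) → X) :=
  {φ | cochainD π n φ = 0}

/-- The space `Bⁿ(G,X) = range ∂ⁿ` of `n`-coboundaries (`B⁰ = {0}`). -/
def Bset (π : G →* (X →L[ℝ] X)) : ∀ n : ℕ, Set ((Fin n → G) → X)
  | 0 => {0}
  | n + 1 => Set.range (cochainD π n)

/-- Restriction of an `n`-cochain on `G` to a subgroup `F`. -/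
def resC (F : Subgroup G) (n : ℕ) (φ : (Fin n → G) → X) : (Fin n → F) → X :=
  fun f => φ fun i => (f i : G)

theorem IsCompact.convexHull_union_of_convex {E : Type*} [AddCommGroup E] [Module ℝ E]
    [TopologicalSpace E] [IsTopologicalAddGroup E] [ContinuousSMul ℝ E] {A B : Set E}
    (hA : IsCompact A) (hA' : Convex ℝ A) (hB : IsCompact B) (hB' : Convex ℝ B) :
    IsCompact (convexHull ℝ (A ∪ B)) := by
  rcases A.eq_empty_or_nonempty with rfl | hAn
  · simpa [hB'.convexHull_eq] using hB
  rcases B.eq_empty_or_nonempty with rfl | hBn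
  · simpa [hA'.convexHull_eq] using hA
  rw [hA'.convexHull_union hB' hAn hBn]
  have : convexJoin ℝ A B =
      (fun p : ℝ × E × E => (1 - p.1) • p.2.1 + p.1 • p.2.2) '' (Set.Icc 0 1 ×ˢ (A ×ˢ B)) := by
    ext x
    simp only [mem_convexJoin, segment_eq_image, Set.mem_image, Set.mem_prod, Prod.exists]
    constructor
    · rintro ⟨a, ha, b, hb, t, ht, rfl⟩
      exact ⟨t, a, b, ⟨ht, ha, hb⟩, rfl⟩
    · rintro ⟨t, a, b, ⟨ht, ha, hb⟩, rfl⟩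
      exact ⟨a, ha, b, hb, t, ht, rfl⟩
  rw [this]
  exact (isCompact_Icc.prod (hA.prod hB)).image (by fun_prop)

theorem isCompact_convexHull_biUnion {E ι : Type*} [AddCommGroup E] [Module ℝ E]
    [TopologicalSpace E] [IsTopologicalAddGroup E] [ContinuousSMul ℝ E] (s : Finset ι)
    {A : ι → Set E} (hA : ∀ i ∈ s, IsCompact (A i)) (hA' : ∀ i ∈ s, Convex ℝ (A i)) :
    IsCompact (convexHull ℝ (⋃ i ∈ s, A i)) := by
  classical
  induction s using Finset.induction_on with
  | empty => simp
  | insert i s hi ih =>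
    rw [Finset.set_biUnion_insert, ← convexHull_convexHull_union_right]
    exact (hA i (by simp)).convexHull_union_of_convex (hA' i (by simp))
      (ih (fun j hj => hA j (by simp [hj])) fun j hj => hA' j (by simp [hj])) (convex_convexHull _ _)

theorem notMem_convexHull_of_mem_extremePoints {E : Type*} [AddCommGroup E] [Module ℝ E]
    {K A : Set E} {z : E} (hK : Convex ℝ K)
    (hz : z ∈ K.extremePoints ℝ) (hA : A ⊆ K) (hzA : z ∉ A) : z ∉ convexHull ℝ A := fun h =>
  (hK.mem_extremePoints_iff_mem_sdiff_convexHull_sdiff.1 hz).2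
    (convexHull_mono (Set.subset_sdiff_singleton hA hzA) h)

section LocallyConvex

variable {E : Type*} [AddCommGroup E] [Module ℝ E] [TopologicalSpace E] [T2Space E]
  [IsTopologicalAddGroup E] [ContinuousSMul ℝ E] [LocallyConvexSpace ℝ E]

/-- **Choquet's lemma**: the slices form a neighbourhood basis of an extreme point. -/
theorem exists_slice_subset_of_mem_extremePoints {K U : Set E} {z : E} (hK : IsCompact K)
    (hK' : Convex ℝ K) (hz : z ∈ K.extremePoints ℝ) (hU : IsOpen U) (hzU : z ∈ U) :
    ∃ (l : StrongDual ℝ E) (a : ℝ), a < l z ∧ ∀ w ∈ K, a < l w → w ∈ U := by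
  have hsep : ∀ p : E, p ≠ z → ∃ (l : StrongDual ℝ E) (a : ℝ), l p < a ∧ a < l z := by
    intro p hp
    obtain ⟨l, hl⟩ := geometric_hahn_banach_point_point hp
    exact ⟨l, exists_between hl⟩
  choose! l a hlp hlz using hsep
  obtain ⟨t, ht, hcov⟩ := (hK.diff hU).elim_nhds_subcover (fun p => {w | l p w < a p})
    (fun p hp => (isOpen_lt (l p).continuous continuous_const).mem_nhds
      (hlp p (fun h => hp.2 (h ▸ hzU))))
  have hne : ∀ p ∈ t, p ≠ z := fun p hp h => (ht p hp).2 (h ▸ hzU)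
  have hcomp : IsCompact (convexHull ℝ (⋃ p ∈ t, K ∩ {w | l p w ≤ a p})) :=
    isCompact_convexHull_biUnion t
      (fun p _ => hK.inter_right (isClosed_le (l p).continuous continuous_const))
      (fun p _ => hK'.inter (convex_halfSpace_le (l p).isLinear (a p)))
  have hzn : z ∉ convexHull ℝ (⋃ p ∈ t, K ∩ {w | l p w ≤ a p}) := by
    refine notMem_convexHull_of_mem_extremePoints hK' hz (by simp) ?_
    simp only [Set.mem_iUnion, Set.mem_inter_iff, Set.mem_ofPred_eq, not_exists, not_and, not_le]
    exact fun p hp _ => hlz p (hne p hp)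
  obtain ⟨f, u, hf, hu⟩ :=
    geometric_hahn_banach_closed_point (convex_convexHull _ _) hcomp.isClosed hzn
  refine ⟨f, u, hu, fun w hw huw => ?_⟩
  by_contra hwU
  obtain ⟨p, hp, hwp⟩ := Set.mem_iUnion₂.1 (hcov ⟨hw, hwU⟩)
  exact (hf w (subset_convexHull _ _ (Set.mem_iUnion₂.2 ⟨p, hp, hw, show l p w ≤ a p from le_of_lt hwp⟩))).not_gt huw

/-- A nonempty compact convex set has slices of arbitrarily small diameter with respect to a
separable norm whose closed balls are closed and in which the set is bounded. -/
theorem exists_slice_norm_sub_lt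
    [TopologicalSpace.SeparableSpace X] (p : E →ₗ[ℝ] X)
    (hp : ∀ (x : X) (r : ℝ), IsClosed (p ⁻¹' Metric.closedBall x r)) {K : Set E}
    (hK : IsCompact K) (hK' : Convex ℝ K) (hne : K.Nonempty) {M : ℝ} (hM : ∀ w ∈ K, ‖p w‖ ≤ M)
    {ε : ℝ} (hε : 0 < ε) :
    ∃ (l : StrongDual ℝ E) (a : ℝ), (∃ z ∈ K, a < l z) ∧
      ∀ u ∈ K, ∀ v ∈ K, a < l u → a < l v → ‖p u - p v‖ < ε := by
  have hM0 : 0 ≤ M := (norm_nonneg _).trans (hM _ hne.some_mem)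
  set W := closure (K.extremePoints ℝ) with hW
  have hWK : W ⊆ K := closure_minimal extremePoints_subset hK.isClosed
  have hWc : IsCompact W := hK.of_isClosed_subset isClosed_closure hWK
  have : Nonempty X := ⟨0⟩
  -- a relatively open piece of `W` of small norm diameter
  obtain ⟨x, z, U, hz, hU, hzU, hUx⟩ : ∃ (x : X) (z : E) (U : Set E), z ∈ K.extremePoints ℝ ∧
      IsOpen U ∧ z ∈ U ∧ ∀ w ∈ U, w ∈ W → p w ∈ Metric.closedBall x (ε / 4) := by
    have : CompactSpace W := isCompact_iff_compactSpace.1 hWc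
    have : Nonempty W := (hK.extremePoints_nonempty hne).closure.to_subtype
    obtain ⟨n, w, hw⟩ := nonempty_interior_of_iUnion_of_closed
      (f := fun n : ℕ => {w : W | p w ∈ Metric.closedBall (TopologicalSpace.denseSeq X n) (ε / 4)})
      (fun n => (hp _ _).preimage continuous_subtype_val) (by
        refine Set.eq_univ_of_forall fun w => ?_
        obtain ⟨n, hn⟩ := (TopologicalSpace.denseRange_denseSeq X).exists_dist_lt (p w)
          (show 0 < ε / 4 by positivity)
        exact Set.mem_iUnion.2 ⟨n, hn.le⟩)
    obtain ⟨t, htn, ht, hwt⟩ := mem_interior.1 hw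
    obtain ⟨U, hU, rfl⟩ := isOpen_induced_iff.1 ht
    obtain ⟨z, hzU, hz⟩ := mem_closure_iff.1 w.2 U hU hwt
    exact ⟨_, z, U, hz, hU, hzU, fun y hyU hyW => @htn ⟨y, hyW⟩ hyU⟩
  obtain ⟨l, a, haz, hl⟩ := exists_slice_subset_of_mem_extremePoints hK hK' hz hU hzU
  set K₁ := K ∩ {w | l w ≤ a} with hK₁
  set K₂ := closure (convexHull ℝ (K.extremePoints ℝ ∩ {w | a < l w})) with hK₂
  have h1c : IsCompact K₁ := hK.inter_right (isClosed_le l.continuous continuous_const)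
  have h1' : Convex ℝ K₁ := hK'.inter (convex_halfSpace_le l.isLinear a)
  have h2K : K₂ ⊆ K := closure_minimal
    (convexHull_min (Set.inter_subset_left.trans extremePoints_subset) hK') hK.isClosed
  have h2c : IsCompact K₂ := hK.of_isClosed_subset isClosed_closure h2K
  have h2' : Convex ℝ K₂ := (convex_convexHull _ _).closure
  have h2x : K₂ ⊆ p ⁻¹' Metric.closedBall x (ε / 4) := closure_minimal
    (convexHull_min (fun w hw => hUx w (hl w hw.1.1 hw.2) (subset_closure hw.1))
      ((convex_closedBall _ _).linear_preimage p)) (hp _ _)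
  have hz2 : z ∈ K₂ := subset_closure (subset_convexHull _ _ ⟨hz, haz⟩)
  have hcov : K ⊆ convexHull ℝ (K₁ ∪ K₂) := by
    conv_lhs => rw [← closure_convexHull_extremePoints hK hK']
    refine closure_minimal (convexHull_min (fun w hw => subset_convexHull _ _ ?_)
      (convex_convexHull _ _)) (h1c.convexHull_union_of_convex h1' h2c h2').isClosed
    rcases le_or_gt (l w) a with h | h
    · exact Or.inl ⟨hw.1, h⟩
    · exact Or.inr (subset_closure (subset_convexHull _ _ ⟨hw, h⟩))
  -- the points of `K` having a definite weight in `K₁`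
  obtain ⟨r, hr0, hr1, hrM⟩ : ∃ r : ℝ, 0 < r ∧ r < 1 ∧ r * (2 * M) < ε / 4 := by
    refine ⟨ε / (ε + 8 * M + 1), by positivity, ?_, ?_⟩
    · rw [div_lt_one (by positivity)]; linarith
    · rw [div_mul_eq_mul_div, div_lt_iff₀ (by positivity)]
      nlinarith
  set D := (fun q : E × E => r • q.1 + (1 - r) • q.2) '' (K₁ ×ˢ K₂) with hD
  have hDc : IsCompact D := (h1c.prod h2c).image (by fun_prop)
  have hD' : Convex ℝ D := (h1'.prod h2').is_linear_image
    ⟨fun x y => by simp; abel, fun c x => by simp [smul_comm c]⟩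
  have hDK : D ⊆ K := by
    rintro _ ⟨⟨u, v⟩, ⟨hu, hv⟩, rfl⟩
    exact hK' hu.1 (h2K hv) hr0.le (by linarith) (by ring)
  have hzC : z ∉ convexHull ℝ (K₁ ∪ D) := by
    refine notMem_convexHull_of_mem_extremePoints hK' hz
      (Set.union_subset Set.inter_subset_left hDK) ?_
    rintro (h | ⟨⟨u, v⟩, ⟨hu, hv⟩, huv⟩)
    · exact (h.2).not_gt haz
    · have : u = z := hz.2 hu.1 (h2K hv) ⟨r, 1 - r, hr0, by linarith, by ring, huv⟩
      exact (this ▸ hu.2 : l z ≤ a).not_gt haz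
  obtain ⟨f, b, hf, hb⟩ := geometric_hahn_banach_closed_point (convex_convexHull _ _)
    (h1c.convexHull_union_of_convex h1' hDc hD').isClosed hzC
  have key : ∀ w ∈ K, b < f w → ‖p w - x‖ < ε / 2 := by
    intro w hw hbw
    have hwC : w ∉ convexHull ℝ (K₁ ∪ D) := fun h => (hf w h).not_gt hbw
    have hw2 := hcov hw
    rcases K₁.eq_empty_or_nonempty with h | h
    · rw [h, Set.empty_union, h2'.convexHull_eq] at hw2
      have := h2x hw2
      rw [Set.mem_preimage, mem_closedBall_iff_norm] at this
      linarith
    rw [h1'.convexHull_union h2' h ⟨z, hz2⟩, mem_convexJoin] at hw2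
    obtain ⟨u, hu, v, hv, hw2⟩ := hw2
    rw [segment_symm, segment_eq_image] at hw2
    obtain ⟨t, ⟨ht0, ht1⟩, rfl⟩ := hw2
    have htr : t < r := by
      by_contra! htr
      refine hwC ?_
      have hd : r • u + (1 - r) • v ∈ D := ⟨(u, v), ⟨hu, hv⟩, rfl⟩
      have h1r : 1 - r ≠ 0 := by linarith
      have hrp : 0 < 1 - r := by linarith
      have := convex_convexHull ℝ (K₁ ∪ D) (subset_convexHull _ _ (Or.inl hu))
        (subset_convexHull _ _ (Or.inr hd)) (a := (t - r) / (1 - r)) (b := (1 - t) / (1 - r))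
        (div_nonneg (by linarith) hrp.le) (div_nonneg (by linarith) hrp.le)
        (by field_simp; ring)
      have e₁ : (t - r) / (1 - r) + (1 - t) / (1 - r) * r = t := by field_simp; ring
      have e₂ : (1 - t) / (1 - r) * (1 - r) = 1 - t := div_mul_cancel₀ _ h1r
      rwa [smul_add, smul_smul, smul_smul, ← add_assoc, ← add_smul, e₁, e₂, add_comm] at this
    have hvx := h2x hv
    rw [Set.mem_preimage, mem_closedBall_iff_norm] at hvx
    have huv : ‖p u - p v‖ ≤ 2 * M := by
      linarith [norm_sub_le (p u) (p v), hM u hu.1, hM v (h2K hv)]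
    have heq : p ((1 - t) • v + t • u) - x = t • (p u - p v) + (p v - x) := by
      rw [map_add, map_smul, map_smul]; module
    rw [heq]
    calc ‖t • (p u - p v) + (p v - x)‖ ≤ t * ‖p u - p v‖ + ‖p v - x‖ := by
          refine (norm_add_le _ _).trans (le_of_eq ?_)
          rw [norm_smul, Real.norm_of_nonneg ht0]
      _ ≤ r * (2 * M) + ε / 4 := by gcongr
      _ < ε / 2 := by linarith
  refine ⟨f, b, ⟨z, hz.1, hb⟩, fun u hu v hv hbu hbv => ?_⟩
  have := norm_sub_le (p u - x) (p v - x)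
  rw [sub_sub_sub_cancel_right] at this
  linarith [key u hu hbu, key v hv hbv]

end LocallyConvex

section Reflexive

theorem isCompact_toWeakSpace_image
    (hrefl : Function.Surjective (NormedSpace.inclusionInDoubleDual ℝ X)) {K : Set X}
    (hK : IsClosed K) (hK' : Convex ℝ K) (hb : Bornology.IsBounded K) :
    IsCompact (toWeakSpace ℝ X '' K) := by
  have hcl : closure (toWeakSpace ℝ X '' K) = toWeakSpace ℝ X '' K := by
    rw [← hK'.toWeakSpace_closure ℝ, hK.closure_eq]
  rw [← hcl]
  refine NormedSpace.isCompact_closure_of_isBounded _ _ _ ?_ fun f _ => ?_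
  · rwa [Set.preimage_image_eq _ (toWeakSpace ℝ X).injective]
  · obtain ⟨x, hx⟩ := hrefl (WeakDual.toStrongDual f)
    exact ⟨toWeakSpace ℝ X x, DFunLike.ext _ _ fun l => DFunLike.congr_fun hx l⟩

theorem isClosed_toWeakSpace_symm_preimage_closedBall (x : X) (r : ℝ) :
    IsClosed ((toWeakSpace ℝ X).symm ⁻¹' Metric.closedBall x r) := by
  have : (toWeakSpace ℝ X).symm ⁻¹' Metric.closedBall x r =
      toWeakSpace ℝ X '' Metric.closedBall x r :=
    ((toWeakSpace ℝ X).toEquiv.image_eq_preimage_symm _).symm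
  rw [this, ← Metric.isClosed_closedBall.closure_eq,
    (convex_closedBall x r).toWeakSpace_closure ℝ]
  exact isClosed_closure

/-- In a separable reflexive space with an isometric group action, a vector which is a convex
combination of its translates is fixed by all group elements involved. -/
theorem apply_eq_self_of_eq_sum [TopologicalSpace.SeparableSpace X] {ι : Type*}
    (hrefl : Function.Surjective (NormedSpace.inclusionInDoubleDual ℝ X))
    (π : G →* (X →L[ℝ] X)) (hiso : ∀ (g : G) (x : X), ‖π g x‖ = ‖x‖)
    {s : Finset ι} {w : ι → ℝ} {c : ι → G} {y : X} (hw : ∀ i ∈ s, 0 < w i)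
    (hw₁ : ∑ i ∈ s, w i = 1) (hy : ∑ i ∈ s, w i • π (c i) y = y) :
    ∀ i ∈ s, π (c i) y = y := by
  classical
  by_contra! hne
  obtain ⟨i₀, hi₀, hne⟩ := hne
  obtain ⟨j, hj, hmin⟩ := (s.filter fun i => π (c i) y ≠ y).exists_min_image
    (fun i => ‖π (c i) y - y‖) ⟨i₀, by simp [hi₀, hne]⟩
  rw [Finset.mem_filter] at hj
  set O : Set X := Set.range fun g => π g y with hO
  set K := closure (convexHull ℝ O) with hK
  have hOK : ∀ g, π g y ∈ K := fun g => subset_closure (subset_convexHull ℝ _ ⟨g, rfl⟩)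
  have hKb : K ⊆ Metric.closedBall 0 ‖y‖ := by
    refine closure_minimal (convexHull_min ?_ (convex_closedBall _ _)) Metric.isClosed_closedBall
    rintro _ ⟨g, rfl⟩
    simp [hiso]
  have hKc := isCompact_toWeakSpace_image hrefl isClosed_closure
    (convex_convexHull ℝ O).closure (Metric.isBounded_closedBall.subset hKb)
  have : LocallyConvexSpace ℝ (WeakSpace ℝ X) := WeakBilin.locallyConvexSpace
  obtain ⟨l, a, ⟨_, ⟨z, hz, rfl⟩, haz⟩, hl⟩ := exists_slice_norm_sub_lt
    (toWeakSpace ℝ X).symm.toLinearMap isClosed_toWeakSpace_symm_preimage_closedBall hKc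
    ((convex_convexHull ℝ O).closure.linear_image (toWeakSpace ℝ X).toLinearMap)
    ⟨_, _, hOK 1, rfl⟩ (M := ‖y‖)
    (by rintro _ ⟨z, hz, rfl⟩; simpa using hKb hz) (norm_pos_iff.2 (sub_ne_zero.2 hj.2))
  set f : X →L[ℝ] ℝ := l.comp (toWeakSpaceCLM ℝ X) with hf
  have hfl : ∀ u, l (toWeakSpace ℝ X u) = f u := fun u => rfl
  obtain ⟨g, hg⟩ : ∃ g, a < f (π g y) := by
    by_contra! h
    have : K ⊆ {u | f u ≤ a} := by
      refine closure_minimal (convexHull_min ?_ (convex_halfSpace_le f.isLinear a))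
        (isClosed_le f.continuous continuous_const)
      rintro _ ⟨g, rfl⟩
      exact h g
    exact (this hz).not_gt haz
  -- some displaced translate lies in the slice
  obtain ⟨i, hi, hig⟩ : ∃ i ∈ s.filter (fun i => π (c i) y ≠ y),
      f (π g y) ≤ f (π (g * c i) y) := by
    by_contra! h
    have hsum : ∑ i ∈ s, w i * f (π (g * c i) y) = f (π g y) := by
      conv_rhs => rw [← hy]
      simp [map_sum, map_mul]
    have hlt : ∑ i ∈ s, w i * f (π (g * c i) y) < ∑ i ∈ s, w i * f (π g y) := by
      refine Finset.sum_lt_sum (fun i hi => ?_) ⟨j, hj.1, ?_⟩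
      · by_cases hiy : π (c i) y = y
        · simp [map_mul, hiy]
        · exact mul_le_mul_of_nonneg_left (h i (by simp [hi, hiy])).le (hw i hi).le
      · exact mul_lt_mul_of_pos_left (h j (by simp [hj.1, hj.2])) (hw j hj.1)
    rw [hsum, ← Finset.sum_mul, hw₁, one_mul] at hlt
    exact lt_irrefl _ hlt
  have := hl _ ⟨_, hOK (g * c i), rfl⟩ _ ⟨_, hOK g, rfl⟩ (hg.trans_le hig) hg
  simp only [LinearEquiv.coe_coe, LinearEquiv.symm_apply_apply, map_mul,
    mul_apply_eq_comp] at this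
  rw [← map_sub, hiso] at this
  exact (hmin i hi).not_gt this

/-- A contraction preserving a closed convex bounded set has a fixed point in it. -/
theorem exists_fixed_point_of_contraction
    (hrefl : Function.Surjective (NormedSpace.inclusionInDoubleDual ℝ X)) {K : Set X}
    (hK : IsClosed K) (hK' : Convex ℝ K) (hb : Bornology.IsBounded K) (hne : K.Nonempty)
    (T : X →L[ℝ] X) (hTK : Set.MapsTo T K K) :
    ∃ y ∈ K, T y = y := by
  obtain ⟨x, hx⟩ := hne
  obtain ⟨M, hM⟩ := hb.exists_norm_le
  have hit : ∀ n : ℕ, (T ^ n) x ∈ K := by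
    intro n
    induction n with
    | zero => simpa
    | succ n ih => rw [pow_succ']; exact hTK ih
  set v : ℕ → X := fun n => ((n + 1 : ℕ) : ℝ)⁻¹ • ∑ k ∈ Finset.range (n + 1), (T ^ k) x with hv
  have hvK : ∀ n, v n ∈ K := by
    intro n
    rw [hv]
    dsimp only
    rw [Finset.smul_sum]
    refine hK'.sum_mem (fun _ _ => by positivity) ?_ fun k _ => hit k
    rw [Finset.sum_const, Finset.card_range, nsmul_eq_mul, mul_inv_cancel₀ (by positivity)]
  have hvT : Filter.Tendsto (fun n => T (v n) - v n) Filter.atTop (nhds 0) := by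
    have h0 : Filter.Tendsto (fun n : ℕ => ((n + 1 : ℕ) : ℝ)⁻¹ * (M + M)) Filter.atTop
        (nhds 0) := by
      simpa using ((tendsto_inv_atTop_nhds_zero_nat (𝕜 := ℝ)).comp
        (Filter.tendsto_add_atTop_nat 1)).mul_const (M + M)
    refine squeeze_zero_norm (fun n => ?_) h0
    have : T (v n) - v n = ((n + 1 : ℕ) : ℝ)⁻¹ • ((T ^ (n + 1)) x - x) := by
      rw [hv]
      dsimp only
      rw [map_smul, map_sum, ← smul_sub, ← Finset.sum_sub_distrib]
      congr 1
      have := Finset.sum_range_sub (fun k => (T ^ k) x) (n + 1)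
      simpa [pow_succ'] using this
    rw [this, norm_smul, Real.norm_of_nonneg (by positivity)]
    gcongr
    exact (norm_sub_le _ _).trans (add_le_add (hM _ (hit _)) (hM _ hx))
  have hKc := isCompact_toWeakSpace_image hrefl hK hK' hb
  obtain ⟨_, ⟨y, hy, rfl⟩, hlim⟩ := hKc.ultrafilter_le_nhds
    ((Ultrafilter.of Filter.atTop : Ultrafilter ℕ).map fun n => toWeakSpace ℝ X (v n))
    (by
      rw [Ultrafilter.coe_map, Filter.le_principal_iff]
      exact Filter.mem_map.2 (Filter.univ_mem' fun n => ⟨v n, hvK n, rfl⟩))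
  refine ⟨y, hy, ?_⟩
  set 𝒰 : Ultrafilter ℕ := Ultrafilter.of Filter.atTop
  have hlim' : Filter.Tendsto (fun n => toWeakSpace ℝ X (v n)) 𝒰 (nhds (toWeakSpace ℝ X y)) := hlim
  have h1 : Filter.Tendsto (fun n => WeakSpace.map T (toWeakSpace ℝ X (v n)) -
      toWeakSpace ℝ X (v n)) 𝒰 (nhds (WeakSpace.map T (toWeakSpace ℝ X y) - toWeakSpace ℝ X y)) :=
    (((WeakSpace.map T).continuous.tendsto _).comp hlim').sub hlim'
  have h2 : Filter.Tendsto (fun n => toWeakSpace ℝ X (T (v n) - v n)) 𝒰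
      (nhds (toWeakSpace ℝ X 0)) :=
    ((toWeakSpaceCLM ℝ X).continuous.tendsto 0).comp (hvT.mono_left (Ultrafilter.of_le _))
  have h3 := tendsto_nhds_unique h1 h2
  exact sub_eq_zero.1 ((toWeakSpace ℝ X).injective h3)

/-- A convex semigroup `S` of contractions of a separable reflexive space, containing the averages
of an isometric action over finite sets covering `N`, contracts every vector to zero as soon as
`N` has no nonzero fixed vector. -/
theorem exists_mem_norm_apply_lt [TopologicalSpace.SeparableSpace X]
    (hrefl : Function.Surjective (NormedSpace.inclusionInDoubleDual ℝ X))
    (π : G →* (X →L[ℝ] X)) (hiso : ∀ (g : G) (x : X), ‖π g x‖ = ‖x‖) {N : Set G}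
    (hinv : ∀ x : X, (∀ g ∈ N, π g x = x) → x = 0) {S : Set (X →L[ℝ] X)} (hS : Convex ℝ S)
    (hSmul : ∀ A ∈ S, ∀ B ∈ S, A * B ∈ S) (hS₁ : 1 ∈ S) (hSc : ∀ T ∈ S, ∀ x, ‖T x‖ ≤ ‖x‖)
    (hN : ∀ g ∈ N, ∃ C : Finset G, g ∈ C ∧ (C.card : ℝ)⁻¹ • ∑ c ∈ C, π c ∈ S)
    (x : X) {ε : ℝ} (hε : 0 < ε) : ∃ T ∈ S, ‖T x‖ < ε := by
  classical
  set O : Set X := (fun T : X →L[ℝ] X => T x) '' S with hO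
  have hOc : Convex ℝ O :=
    hS.is_linear_image ⟨fun A B => by simp, fun r A => by simp⟩
  have hxK : x ∈ closure O := subset_closure ⟨1, hS₁, rfl⟩
  have hb : Bornology.IsBounded (closure O) := by
    refine Metric.isBounded_closedBall.subset (closure_minimal (t := Metric.closedBall 0 ‖x‖) ?_
      Metric.isClosed_closedBall)
    rintro _ ⟨T, hT, rfl⟩
    simpa using hSc T hT x
  have hSK : ∀ T ∈ S, Set.MapsTo T (closure O) (closure O) := by
    intro T hT
    refine Set.MapsTo.closure ?_ T.continuous
    rintro _ ⟨A, hA, rfl⟩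
    exact ⟨T * A, hSmul T hT A hA, rfl⟩
  choose! C hgC hCS using hN
  have hKc := isCompact_toWeakSpace_image hrefl isClosed_closure hOc.closure hb
  obtain ⟨_, ⟨y, hy, rfl⟩, hyN⟩ := hKc.inter_iInter_nonempty
    (fun g : N => {u : WeakSpace ℝ X | WeakSpace.map (π g) u = u})
    (fun g => isClosed_eq (WeakSpace.map (π g)).continuous continuous_id) (fun t => by
      rcases t.eq_empty_or_nonempty with rfl | ht
      · exact ⟨_, ⟨x, hxK, rfl⟩, by simp⟩
      have hcard : ∀ g ∈ N, 0 < ((C g).card : ℝ) := fun g hg =>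
        Nat.cast_pos.2 (Finset.card_pos.2 ⟨g, hgC g hg⟩)
      have htpos : 0 < (t.card : ℝ) := Nat.cast_pos.2 (Finset.card_pos.2 ht)
      have hT : ∑ g ∈ t, (t.card : ℝ)⁻¹ • (((C g).card : ℝ)⁻¹ • ∑ c ∈ C g, π c) ∈ S :=
        hS.sum_mem (fun _ _ => by positivity)
          (by rw [Finset.sum_const, nsmul_eq_mul, mul_inv_cancel₀ htpos.ne'])
          fun g _ => hCS g g.2
      obtain ⟨y, hyK, hy⟩ := exists_fixed_point_of_contraction hrefl isClosed_closure hOc.closure hb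
        ⟨x, hxK⟩ _ (hSK _ hT)
      have hfix := apply_eq_self_of_eq_sum hrefl π hiso (s := t.sigma fun g : N => C g)
        (w := fun p => (t.card : ℝ)⁻¹ * ((C p.1).card : ℝ)⁻¹) (c := fun p => p.2) (y := y)
        (fun p _ => mul_pos (inv_pos.2 htpos) (inv_pos.2 (hcard _ p.1.2)))
        (by
          rw [Finset.sum_sigma]
          have : ∀ g ∈ t, ∑ c ∈ C g, (t.card : ℝ)⁻¹ * ((C g).card : ℝ)⁻¹ = (t.card : ℝ)⁻¹ := by
            intro g _
            have := (hcard g g.2).ne'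
            rw [Finset.sum_const, nsmul_eq_mul]
            field_simp
          rw [Finset.sum_congr rfl this, Finset.sum_const, nsmul_eq_mul,
            mul_inv_cancel₀ htpos.ne'])
        (by
          rw [Finset.sum_sigma]
          conv_rhs => rw [← hy]
          simp [Finset.smul_sum, mul_smul])
      refine ⟨_, ⟨y, hyK, rfl⟩, Set.mem_iInter₂.2 fun g hg => ?_⟩
      exact hfix ⟨g, g⟩ (Finset.mem_sigma.2 ⟨hg, hgC g g.2⟩))
  have hy0 : y = 0 := hinv y fun g hg => Set.mem_iInter.1 hyN ⟨g, hg⟩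
  obtain ⟨_, ⟨T, hT, rfl⟩, hlt⟩ := Metric.mem_closure_iff.1 hy ε hε
  exact ⟨T, hT, by simpa [hy0, dist_eq_norm] using hlt⟩

theorem exists_mem_forall_norm_apply_lt {ι : Type*} {S : Set (X →L[ℝ] X)}
    (hSmul : ∀ A ∈ S, ∀ B ∈ S, A * B ∈ S) (hS₁ : 1 ∈ S) (hSc : ∀ T ∈ S, ∀ x, ‖T x‖ ≤ ‖x‖)
    (h : ∀ (x : X) (ε : ℝ), 0 < ε → ∃ T ∈ S, ‖T x‖ < ε) (v : ι → X) {ε : ι → ℝ}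
    (hε : ∀ i, 0 < ε i) (s : Finset ι) :
    ∃ T ∈ S, ∀ i ∈ s, ‖T (v i)‖ < ε i := by
  classical
  induction s using Finset.induction_on with
  | empty => exact ⟨1, hS₁, by simp⟩
  | insert i s hi ih =>
    obtain ⟨T, hT, hTs⟩ := ih
    obtain ⟨A, hA, hAi⟩ := h (T (v i)) (ε i) (hε i)
    refine ⟨A * T, hSmul A hA T hT, fun j hj => ?_⟩
    rcases Finset.mem_insert.1 hj with rfl | hj
    · exact hAi
    · exact (hSc A hA _).trans_lt (hTs j hj)

end Reflexive

section Homotopy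

/-- The part of the coboundary operator which does not involve the action. -/
def innerD (n : ℕ) (φ : (Fin n → G) → X) (g : Fin (n + 1) → G) : X :=
  ((-1 : ℝ) ^ n) • φ (fun i => g i.castSucc)
    - ∑ k : Fin n, ((-1 : ℝ) ^ ((k : ℕ) + 1)) •
        φ (fun j => if (j : ℕ) < (k : ℕ) then g j.castSucc
          else if (j : ℕ) = (k : ℕ) then g k.castSucc * g k.succ
          else g j.succ)

theorem cochainD_eq (π : G →* (X →L[ℝ] X)) (n : ℕ) (φ : (Fin n → G) → X) (g : Fin (n + 1) → G) :
    cochainD π n φ g = innerD n φ g - π (g 0) (φ (Fin.tail g)) := by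
  simp only [cochainD, innerD]
  rw [show Fin.tail g = fun i => g i.succ from rfl]
  abel

theorem innerD_zero (φ : (Fin 0 → G) → X) (g : Fin 1 → G) : innerD 0 φ g = φ Fin.elim0 := by
  simp [innerD, Subsingleton.elim (fun i : Fin 0 => g i.castSucc) Fin.elim0]

theorem innerD_cons (n : ℕ) (φ : (Fin (n + 1) → G) → X) (a : G) (g : Fin (n + 1) → G) :
    innerD (n + 1) φ (Fin.cons a g) =
      φ (Fin.cons (a * g 0) (Fin.tail g)) - innerD n (fun t => φ (Fin.cons a t)) g := by
  have h₀ : (fun i : Fin (n + 1) => (Fin.cons a g : Fin (n + 2) → G) i.castSucc) =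
      Fin.cons a fun i => g i.castSucc := by
    funext j
    refine Fin.cases ?_ (fun j => ?_) j
    · simp
    · simp
  have h₁ : (fun j : Fin (n + 1) => if (j : ℕ) < ((0 : Fin (n + 1)) : ℕ)
        then (Fin.cons a g : Fin (n + 2) → G) j.castSucc
      else if (j : ℕ) = ((0 : Fin (n + 1)) : ℕ)
        then (Fin.cons a g : Fin (n + 2) → G) (0 : Fin (n + 1)).castSucc *
          (Fin.cons a g : Fin (n + 2) → G) (0 : Fin (n + 1)).succ
      else (Fin.cons a g : Fin (n + 2) → G) j.succ) = Fin.cons (a * g 0) (Fin.tail g) := by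
    funext j
    refine Fin.cases ?_ (fun j => ?_) j
    · simp
    · simp [Fin.tail]
  have h₂ : ∀ k : Fin n, (fun j : Fin (n + 1) => if (j : ℕ) < (k.succ : ℕ)
        then (Fin.cons a g : Fin (n + 2) → G) j.castSucc
      else if (j : ℕ) = (k.succ : ℕ)
        then (Fin.cons a g : Fin (n + 2) → G) k.succ.castSucc *
          (Fin.cons a g : Fin (n + 2) → G) k.succ.succ
      else (Fin.cons a g : Fin (n + 2) → G) j.succ) =
      Fin.cons a fun j => if (j : ℕ) < (k : ℕ) then g j.castSucc
          else if (j : ℕ) = (k : ℕ) then g k.castSucc * g k.succ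
          else g j.succ := by
    intro k
    funext j
    refine Fin.cases ?_ (fun j => ?_) j
    · simp
    · simp
  simp only [innerD, Fin.sum_univ_succ, h₀, h₁, h₂]
  simp only [Fin.val_zero, Fin.val_succ, pow_succ, pow_zero, mul_neg, mul_one, neg_smul, one_smul,
    Finset.sum_neg_distrib, neg_neg]
  abel

theorem innerD_sub (n : ℕ) (φ ψ : (Fin n → G) → X) (g : Fin (n + 1) → G) :
    innerD n (fun t => φ t - ψ t) g = innerD n φ g - innerD n ψ g := by
  simp only [innerD, smul_sub, Finset.sum_sub_distrib]
  abel

theorem innerD_sum {ι : Type*} (s : Finset ι) (n : ℕ) (φ : ι → (Fin n → G) → X)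
    (g : Fin (n + 1) → G) :
    innerD n (fun t => ∑ i ∈ s, φ i t) g = ∑ i ∈ s, innerD n (φ i) g := by
  simp only [innerD, Finset.smul_sum, Finset.sum_sub_distrib]
  rw [Finset.sum_comm]

/-- The alternating sum of all insertions of an element of `C` into the arguments of a cochain. -/
def insertSum (C : Finset G) : ∀ n : ℕ, ((Fin (n + 1) → G) → X) → (Fin n → G) → X
  | 0, φ, a => ∑ c ∈ C, φ (Fin.cons c a)
  | n + 1, φ, a =>
    ∑ c ∈ C, φ (Fin.cons c a) - insertSum C n (fun t => φ (Fin.cons (a 0) t)) (Fin.tail a)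

omit [Group G] [NormedSpace ℝ X] in
theorem insertSum_cons (C : Finset G) (n : ℕ) (φ : (Fin (n + 2) → G) → X) (a : G)
    (t : Fin n → G) : insertSum C (n + 1) φ (Fin.cons a t) =
      ∑ c ∈ C, φ (Fin.cons c (Fin.cons a t)) - insertSum C n (fun t => φ (Fin.cons a t)) t := by
  rw [insertSum, Fin.cons_zero, Fin.tail_cons]

omit [Group G] [NormedSpace ℝ X] in
theorem insertSum_sub (C : Finset G) (n : ℕ) (φ ψ : (Fin (n + 1) → G) → X) (a : Fin n → G) :
    insertSum C n (fun t => φ t - ψ t) a = insertSum C n φ a - insertSum C n ψ a := by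
  induction n with
  | zero => simp [insertSum]
  | succ n ih =>
    simp only [insertSum, ih, Finset.sum_sub_distrib]
    abel

omit [Group G] [NormedSpace ℝ X] in
theorem insertSum_zero (C : Finset G) (n : ℕ) (a : Fin n → G) :
    insertSum C n (fun _ => (0 : X)) a = 0 := by
  simpa using insertSum_sub C n (fun _ => (0 : X)) (fun _ => 0) a

omit [Group G] in
theorem insertSum_map (C : Finset G) (n : ℕ) (T : X →L[ℝ] X) (φ : (Fin (n + 1) → G) → X)
    (a : Fin n → G) : insertSum C n (fun t => T (φ t)) a = T (insertSum C n φ a) := by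
  induction n with
  | zero => simp [insertSum]
  | succ n ih => simp only [insertSum, ih, map_sub, map_sum]

theorem sum_mul_left_eq_sum_mul_right {M : Type*} [AddCommMonoid M] {C : Finset G} {f : G}
    (hC : ∀ c ∈ C, f * c * f⁻¹ ∈ C) (hC' : ∀ c ∈ C, f⁻¹ * c * f ∈ C) (ψ : G → M) :
    ∑ c ∈ C, ψ (f * c) = ∑ c ∈ C, ψ (c * f) :=
  Finset.sum_bij' (fun c _ => f * c * f⁻¹) (fun c _ => f⁻¹ * c * f) hC hC'
    (fun c _ => by group) (fun c _ => by group) (fun c _ => by group)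

variable {F : Subgroup G} {C : Finset G}

theorem insertSum_innerD_add (hC : ∀ f ∈ F, ∀ c ∈ C, f * c * f⁻¹ ∈ C) (n : ℕ)
    (φ : (Fin (n + 1) → G) → X) (a : Fin (n + 1) → G) (ha : ∀ i, a i ∈ F) :
    insertSum C (n + 1) (innerD (n + 1) φ) a + innerD n (insertSum C n φ) a =
      (C.card : ℝ) • φ a := by
  have hswap : ∀ f ∈ F, ∀ ψ : G → X, ∑ c ∈ C, ψ (f * c) = ∑ c ∈ C, ψ (c * f) := fun f hf ψ =>
    sum_mul_left_eq_sum_mul_right (hC f hf)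
      (by simpa using hC f⁻¹ (F.inv_mem hf)) ψ
  induction n with
  | zero =>
    obtain ⟨b, t, rfl⟩ : ∃ b t, a = Fin.cons b t := ⟨_, _, (Fin.cons_self_tail a).symm⟩
    have hb : b ∈ F := by simpa using ha 0
    have ht : t = Fin.elim0 := Subsingleton.elim _ _
    subst ht
    rw [insertSum_cons, innerD_zero]
    simp only [innerD_cons, innerD_zero, insertSum, Fin.cons_zero, Fin.tail_cons,
      Finset.sum_sub_distrib, Finset.sum_const]
    rw [hswap b hb fun x => φ (Fin.cons x Fin.elim0), ← Nat.cast_smul_eq_nsmul ℝ]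
    abel
  | succ n ih =>
    obtain ⟨f, s, rfl⟩ : ∃ f s, a = Fin.cons f s := ⟨_, _, (Fin.cons_self_tail a).symm⟩
    obtain ⟨b, t, rfl⟩ : ∃ b t, s = Fin.cons b t := ⟨_, _, (Fin.cons_self_tail s).symm⟩
    have hf : f ∈ F := by simpa using ha 0
    rw [← ih (fun t => φ (Fin.cons f t)) (Fin.cons b t) fun i => by simpa using ha i.succ]
    rw [insertSum_cons]
    simp only [innerD_cons, insertSum_cons, insertSum_sub, innerD_sub, innerD_sum, Fin.cons_zero,
      Fin.tail_cons, Finset.sum_sub_distrib]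
    rw [hswap f hf fun x => φ (Fin.cons x (Fin.cons b t))]
    abel

theorem insertSum_cochainD_add (π : G →* (X →L[ℝ] X))
    (hC : ∀ f ∈ F, ∀ c ∈ C, f * c * f⁻¹ ∈ C) (n : ℕ)
    (φ : (Fin (n + 1) → G) → X) (a : Fin (n + 1) → G) (ha : ∀ i, a i ∈ F) :
    insertSum C (n + 1) (cochainD π (n + 1) φ) a + cochainD π n (insertSum C n φ) a =
      (C.card : ℝ) • φ a - ∑ c ∈ C, π c (φ a) := by
  rw [← insertSum_innerD_add hC n φ a ha, funext (cochainD_eq π (n + 1) φ), cochainD_eq,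
    insertSum_sub]
  have : insertSum C (n + 1) (fun g => π (g 0) (φ (Fin.tail g))) a =
      ∑ c ∈ C, π c (φ a) - π (a 0) (insertSum C n φ (Fin.tail a)) := by
    simp [insertSum, insertSum_map]
  rw [this]
  abel

theorem cochainD_resC (π : G →* (X →L[ℝ] X)) (n : ℕ) (φ : (Fin n → G) → X)
    (a : Fin (n + 1) → F) :
    cochainD (π.comp F.subtype) n (resC F n φ) a = cochainD π n φ fun i => a i := by
  simp only [cochainD, resC, MonoidHom.comp_apply, Subgroup.subtype_apply]
  congr! 6
  split_ifs <;> simp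

theorem cochainD_add (π : G →* (X →L[ℝ] X)) (n : ℕ) (φ ψ : (Fin n → G) → X)
    (g : Fin (n + 1) → G) :
    cochainD π n (fun t => φ t + ψ t) g = cochainD π n φ g + cochainD π n ψ g := by
  simp only [cochainD, map_add, smul_add, Finset.sum_add_distrib]
  abel

theorem cochainD_map (π : G →* (X →L[ℝ] X)) (n : ℕ) (T : X →L[ℝ] X)
    (hT : ∀ g x, T (π g x) = π g (T x)) (φ : (Fin n → G) → X) (g : Fin (n + 1) → G) :
    cochainD π n (fun t => T (φ t)) g = T (cochainD π n φ g) := by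
  simp only [cochainD, map_sub, map_add, map_neg, map_smul, map_sum, hT]

end Homotopy

/-- The contractions which commute with `F` and act trivially on the class of the restriction
of `φ` to `F`. -/
def trivialContractions (π : G →* (X →L[ℝ] X)) (F : Subgroup G) (n : ℕ)
    (φ : (Fin (n + 1) → G) → X) : Set (X →L[ℝ] X) :=
  {T | (∀ x, ‖T x‖ ≤ ‖x‖) ∧ (∀ (f : F) x, T (π f x) = π f (T x)) ∧
    ∃ ψ : (Fin n → F) → X, ∀ a, cochainD (π.comp F.subtype) n ψ a =
      resC F (n + 1) φ a - T (resC F (n + 1) φ a)}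

section TrivialContractions

variable {π : G →* (X →L[ℝ] X)} {F : Subgroup G} {n : ℕ} {φ : (Fin (n + 1) → G) → X}

theorem one_mem_trivialContractions : 1 ∈ trivialContractions π F n φ :=
  ⟨fun x => le_rfl, fun f x => rfl, fun _ => 0, fun a => by simp [cochainD]⟩

theorem mul_mem_trivialContractions {A B : X →L[ℝ] X} (hA : A ∈ trivialContractions π F n φ)
    (hB : B ∈ trivialContractions π F n φ) : A * B ∈ trivialContractions π F n φ := by
  obtain ⟨hA₁, hA₂, ψ, hψ⟩ := hA
  obtain ⟨hB₁, hB₂, χ, hχ⟩ := hB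
  refine ⟨fun x => (hA₁ _).trans (hB₁ x), fun f x => ?_, fun t => ψ t + A (χ t), fun a => ?_⟩
  · simp [hA₂, hB₂]
  · rw [cochainD_add, cochainD_map _ _ _ (fun f x => hA₂ f x), hψ, hχ]
    simp

theorem convex_trivialContractions : Convex ℝ (trivialContractions π F n φ) := by
  rintro A ⟨hA₁, hA₂, ψ, hψ⟩ B ⟨hB₁, hB₂, χ, hχ⟩ r s hr hs hrs
  refine ⟨fun x => ?_, fun f x => ?_, fun t => (r • 1 : X →L[ℝ] X) (ψ t) + (s • 1 : X →L[ℝ] X) (χ t),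
    fun a => ?_⟩
  · calc ‖(r • A + s • B) x‖ ≤ ‖r • A x‖ + ‖s • B x‖ := norm_add_le _ _
      _ = r * ‖A x‖ + s * ‖B x‖ := by
        rw [norm_smul, norm_smul, Real.norm_of_nonneg hr, Real.norm_of_nonneg hs]
      _ ≤ r * ‖x‖ + s * ‖x‖ := by gcongr <;> simp [hA₁, hB₁]
      _ = ‖x‖ := by rw [← add_mul, hrs, one_mul]
  · simp [hA₂, hB₂]
  · rw [cochainD_add, cochainD_map _ _ _ (by simp), cochainD_map _ _ _ (by simp), hψ, hχ]
    obtain rfl : s = 1 - r := by linarith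
    simp only [add_apply, smul_apply, one_apply_eq_self]
    module

theorem average_mem_trivialContractions (hiso : ∀ (g : G) (x : X), ‖π g x‖ = ‖x‖)
    (hφ : φ ∈ Zset π (n + 1)) {C : Finset G} (hne : C.Nonempty)
    (hC : ∀ f ∈ F, ∀ c ∈ C, f * c * f⁻¹ ∈ C) :
    (C.card : ℝ)⁻¹ • ∑ c ∈ C, π c ∈ trivialContractions π F n φ := by
  have hcard : (C.card : ℝ) ≠ 0 := Nat.cast_ne_zero.2 (Finset.card_pos.2 hne).ne'
  refine ⟨fun x => ?_, fun f x => ?_,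
    fun t => ((C.card : ℝ)⁻¹ • 1 : X →L[ℝ] X) (resC F n (insertSum C n φ) t), fun a => ?_⟩
  · calc ‖((C.card : ℝ)⁻¹ • ∑ c ∈ C, π c) x‖ = (C.card : ℝ)⁻¹ * ‖∑ c ∈ C, π c x‖ := by
          simp [norm_smul]
      _ ≤ (C.card : ℝ)⁻¹ * ∑ c ∈ C, ‖π c x‖ := by gcongr; exact norm_sum_le _ _
      _ = ‖x‖ := by simp [hiso, hcard]
  · have := sum_mul_left_eq_sum_mul_right (hC f f.2) (by simpa using hC _ (F.inv_mem f.2))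
      fun g => π g x
    simpa using congrArg ((C.card : ℝ)⁻¹ • ·) this.symm
  · rw [cochainD_map _ _ _ (by simp), cochainD_resC]
    have h := insertSum_cochainD_add π hC n φ (fun i => (a i : G)) fun i => (a i).2
    rw [show cochainD π (n + 1) φ = fun _ => 0 from hφ, insertSum_zero, zero_add] at h
    rw [h]
    simp [smul_sub, hcard, resC]

end TrivialContractions

/-- If `(X,π)` is a separable reflexive isometric Banach `G`-module and `F ≤ G` with
`X^{FC_G(F)} = {0}`, then for every `n` the restriction map on reduced cohomology
`H̄ⁿ(G,X) → H̄ⁿ(F,X)` is zero: every `n`-cocycle of `G` restricts on `F` into the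
closure of `Bⁿ(F,X)` in the topology of pointwise convergence. -/
theorem restriction_reduced_Hn_zero
    [CompleteSpace X] [TopologicalSpace.SeparableSpace X]
    (hrefl : Function.Surjective (NormedSpace.inclusionInDoubleDual ℝ X))
    (π : G →* (X →L[ℝ] X)) (hiso : ∀ (g : G) (x : X), ‖π g x‖ = ‖x‖)
    (F : Subgroup G)
    (hinv : ∀ x : X, (∀ g ∈ FCset F, π g x = x) → x = 0) :
    ∀ (n : ℕ) (φ : (Fin n → G) → X), φ ∈ Zset π n →
      resC F n φ ∈ closure (Bset (π.comp F.subtype) n) := by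
  intro n φ hφ
  cases n with
  | zero =>
    have h0 : φ = 0 := by
      funext g
      refine hinv _ fun f _ => ?_
      have := congrFun (show cochainD π 0 φ = 0 from hφ) fun _ => f
      rw [cochainD_eq, innerD_zero, Pi.zero_apply, sub_eq_zero,
        Subsingleton.elim (Fin.tail fun _ : Fin 1 => f) Fin.elim0] at this
      rw [Subsingleton.elim g Fin.elim0, ← this]
    refine subset_closure ?_
    rw [h0]
    rfl
  | succ n =>
    have hS := fun x ε hε => exists_mem_norm_apply_lt hrefl π hiso hinv
      (convex_trivialContractions (π := π) (F := F) (φ := φ))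
      (fun _ hA _ hB => mul_mem_trivialContractions hA hB) one_mem_trivialContractions
      (fun T hT => hT.1) (fun g hg => by
        have hg' : Set.Finite {x | ∃ f ∈ F, x = f * g * f⁻¹} := hg
        have hmem : g ∈ hg'.toFinset := hg'.mem_toFinset.2 ⟨1, F.one_mem, by simp⟩
        refine ⟨hg'.toFinset, hmem, average_mem_trivialContractions hiso hφ ⟨g, hmem⟩ ?_⟩
        intro f hf c hc
        obtain ⟨f', hf', rfl⟩ := hg'.mem_toFinset.1 hc
        exact hg'.mem_toFinset.2 ⟨f * f', F.mul_mem hf hf', by group⟩) x (ε := ε) hε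
    refine mem_closure_iff.2 fun U hU hφU => ?_
    obtain ⟨I, u, hu, hIU⟩ := isOpen_pi_iff.1 hU _ hφU
    have hball : ∀ a, ∃ ε : ℝ, 0 < ε ∧
        (a ∈ I → Metric.ball (resC F (n + 1) φ a) ε ⊆ u a) := by
      intro a
      by_cases ha : a ∈ I
      · obtain ⟨ε, hε, h⟩ := Metric.isOpen_iff.1 (hu a ha).1 _ (hu a ha).2
        exact ⟨ε, hε, fun _ => h⟩
      · exact ⟨1, one_pos, fun h => absurd h ha⟩
    choose ε hε hball using hball
    obtain ⟨T, ⟨-, -, ψ, hψ⟩, hT⟩ := exists_mem_forall_norm_apply_lt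
      (fun _ hA _ hB => mul_mem_trivialContractions hA hB) one_mem_trivialContractions
      (fun T hT => hT.1) hS (resC F (n + 1) φ) hε I
    refine ⟨cochainD (π.comp F.subtype) n ψ, hIU fun a ha => hball a ha ?_, ψ, rfl⟩
    rw [hψ, mem_ball_iff_norm, sub_sub_cancel_left, norm_neg]
    exact hT a ha
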